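/- Let (X,E) be a separable type B space and (Y,F) a separable countably generated measurable space. Then every bijective measurable map f : (X,E) → (Y,F) is an isomorphism; that is, the inverse map f⁻¹ : (Y,F) → (X,E) is also measurable. -/

import Mathlib

open MeasureTheory

/-- A map `f : (X,E) → (Y,F)` between measurable spaces is *exactly measurable* if
`f⁻¹(F) = E`. -/
def ExactlyMeasurable {X Y : Type*} [mX : MeasurableSpace X] [mY : MeasurableSpace Y]
    (f : X → Y) : Prop :=
  MeasurableSpace.comap f mY = mX

/-- A countably generated measurable space `(X,E)` is a *type B space* if there is an
exactly measurable map `f : (X,E) → (M,B)` into the Cantor space whose range is Borel. -/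
def IsTypeB (X : Type*) [MeasurableSpace X] : Prop :=
  MeasurableSpace.CountablyGenerated X ∧
    ∃ f : X → (ℕ → Bool), ExactlyMeasurable f ∧ MeasurableSet (Set.range f)

/-- An exactly measurable map out of a space with measurable singletons is injective. -/
theorem ExactlyMeasurable.injective {X Y : Type*} [MeasurableSpace X] [MeasurableSpace Y]
    [MeasurableSingletonClass X] {f : X → Y} (hf : ExactlyMeasurable f) :
    Function.Injective f := by
  intro x y hxy
  have hx := measurableSet_singleton x
  rw [← hf] at hx
  obtain ⟨B, -, hB⟩ := hx
  have hxB : x ∈ f ⁻¹' B := hB ▸ Set.mem_singleton x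
  have hyB : y ∈ f ⁻¹' B := by rwa [Set.mem_preimage, ← hxy]
  rw [hB] at hyB
  exact (Set.mem_singleton_iff.mp hyB).symm

/-- A type B space with measurable singletons embeds measurably into the Cantor space. -/
theorem IsTypeB.exists_measurableEmbedding {X : Type*} [MeasurableSpace X]
    [MeasurableSingletonClass X] (hX : IsTypeB X) :
    ∃ i : X → (ℕ → Bool), MeasurableEmbedding i := by
  obtain ⟨-, i, hi, hrange⟩ := hX
  exact ⟨i, MeasurableEmbedding.iff_comap_eq.mpr ⟨hi.injective, hi, hrange⟩⟩

/-- An injective measurable map from a type B space with measurable singletons to a countably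
separated space is a measurable embedding. -/
theorem IsTypeB.measurableEmbedding {X Y : Type*} [MeasurableSpace X] [MeasurableSpace Y]
    [MeasurableSingletonClass X] (hX : IsTypeB X) [MeasurableSpace.CountablySeparated Y]
    {f : X → Y} (hf : Measurable f) (hinj : Function.Injective f) : MeasurableEmbedding f := by
  obtain ⟨i, hi⟩ := hX.exists_measurableEmbedding
  let e := hi.equivRange
  have := hi.measurableSet_range.standardBorel
  have hfe : MeasurableEmbedding (f ∘ e.symm) :=
    (hf.comp e.symm.measurable).measurableEmbedding (hinj.comp e.symm.injective)
  simpa [Function.comp_assoc] using hfe.comp e.measurableEmbedding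

/-- Let `(X,E)` be a separable type B space and `(Y,F)` a separable countably generated
measurable space.  Then every bijective measurable map `f : (X,E) → (Y,F)` is an
isomorphism: its inverse is also measurable. -/
theorem stmt4 {X Y : Type*} [MeasurableSpace X] [MeasurableSpace Y]
    [MeasurableSingletonClass X] [MeasurableSingletonClass Y]
    (hX : IsTypeB X) [MeasurableSpace.CountablyGenerated Y]
    (f : X → Y) (hf : Measurable f) (hbij : Function.Bijective f) :
    ∃ g : Y → X, Function.LeftInverse g f ∧ Function.RightInverse g f ∧ Measurable g := by
  have hemb : MeasurableEmbedding f := hX.measurableEmbedding hf hbij.injective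
  let e := Equiv.ofBijective f hbij
  refine ⟨e.symm, e.left_inv, e.right_inv, fun s hs => ?_⟩
  rw [← e.image_eq_preimage_symm]
  exact hemb.measurableSet_image.mpr hs
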